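/- The square of the 10-cycle admits a star 9-edge-coloring; that is, χ'_star(C_10²) ≤ 9. -/

import Mathlib

/-- A star `k`-edge-coloring of `G`: a proper edge-coloring (adjacent edges get
distinct colors) such that no path and no cycle with exactly four edges is
bicolored.  The walks `v₀v₁v₂v₃v₄` with consecutive vertices adjacent and with
`v₀,v₁,v₂,v₃` pairwise distinct and `v₁,v₂,v₃,v₄` pairwise distinct are exactly
the paths (when `v₀ ≠ v₄`) and cycles (when `v₀ = v₄`) with four edges; being
bicolored under a proper coloring means the colors alternate. -/
def IsStarEdgeColoring {V : Type*} (G : SimpleGraph V) {k : ℕ} (c : Sym2 V → Fin k) : Prop :=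
  (∀ ⦃u v w : V⦄, G.Adj u v → G.Adj u w → v ≠ w → c s(u, v) ≠ c s(u, w)) ∧
  (∀ v₀ v₁ v₂ v₃ v₄ : V, G.Adj v₀ v₁ → G.Adj v₁ v₂ → G.Adj v₂ v₃ → G.Adj v₃ v₄ →
    v₀ ≠ v₂ → v₀ ≠ v₃ → v₁ ≠ v₃ → v₁ ≠ v₄ → v₂ ≠ v₄ →
    ¬(c s(v₀, v₁) = c s(v₂, v₃) ∧ c s(v₁, v₂) = c s(v₃, v₄)))

/-- The star chromatic index of `G`: the least `k` such that `G` admits a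
star `k`-edge-coloring. -/
noncomputable def starChromaticIndex {V : Type*} (G : SimpleGraph V) : ℕ :=
  sInf {k : ℕ | ∃ c : Sym2 V → Fin k, IsStarEdgeColoring G c}

/-- The square `Cₙ²` of the cycle on `n` vertices: vertices `ZMod n`, with `i`
adjacent to `j` iff `i ≠ j` and `i - j ≡ ±1` or `±2 (mod n)`. -/
def cycleSq (n : ℕ) : SimpleGraph (ZMod n) :=
  SimpleGraph.fromRel (fun a b => a - b = 1 ∨ a - b = 2)

/-- Colors of the edges `{i, i + 1}` of `C₁₀²`. -/
def shortColor : ZMod 10 → Fin 9 := ![0, 2, 4, 5, 0, 2, 4, 7, 8, 2]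

/-- Colors of the edges `{i, i + 2}` of `C₁₀²`. -/
def longColor : ZMod 10 → Fin 9 := ![1, 3, 3, 1, 6, 3, 5, 5, 3, 6]

/-- The color of the pair `{a, b}`, with a dummy value on non-edges of `C₁₀²`. -/
def pairColor (a b : ZMod 10) : Fin 9 :=
  if b - a = 1 then shortColor a
  else if b - a = 2 then longColor a
  else if a - b = 1 then shortColor b
  else if a - b = 2 then longColor b
  else 0

theorem pairColor_comm : ∀ a b, pairColor a b = pairColor b a := by
  decide +kernel

/-- A star 9-edge-coloring of `C₁₀²`. -/
def cycleSqTenColoring : Sym2 (ZMod 10) → Fin 9 :=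
  Sym2.lift ⟨pairColor, pairColor_comm⟩

instance : DecidableRel (cycleSq 10).Adj := fun a b =>
  inferInstanceAs (Decidable (a ≠ b ∧ ((a - b = 1 ∨ a - b = 2) ∨ (b - a = 1 ∨ b - a = 2))))

theorem pairColor_proper : ∀ u v, (cycleSq 10).Adj u v → ∀ w, (cycleSq 10).Adj u w →
    v ≠ w → pairColor u v ≠ pairColor u w := by
  decide +kernel

theorem pairColor_not_bicolored : ∀ v₀ v₁, (cycleSq 10).Adj v₀ v₁ →
    ∀ v₂, (cycleSq 10).Adj v₁ v₂ → v₀ ≠ v₂ →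
    ∀ v₃, (cycleSq 10).Adj v₂ v₃ → v₀ ≠ v₃ → v₁ ≠ v₃ → pairColor v₀ v₁ = pairColor v₂ v₃ →
    ∀ v₄, (cycleSq 10).Adj v₃ v₄ → v₁ ≠ v₄ → v₂ ≠ v₄ →
    pairColor v₁ v₂ ≠ pairColor v₃ v₄ := by
  decide +kernel

theorem isStarEdgeColoring_cycleSqTenColoring :
    IsStarEdgeColoring (cycleSq 10) cycleSqTenColoring :=
  ⟨fun u v w huv huw hvw => pairColor_proper u v huv w huw hvw,
    fun v₀ v₁ v₂ v₃ v₄ h₀₁ h₁₂ h₂₃ h₃₄ n₀₂ n₀₃ n₁₃ n₁₄ n₂₄ h =>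
      pairColor_not_bicolored v₀ v₁ h₀₁ v₂ h₁₂ n₀₂ v₃ h₂₃ n₀₃ n₁₃ h.1 v₄ h₃₄ n₁₄ n₂₄ h.2⟩

/-- `χ'_star(C₁₀²) ≤ 9`: the square of the 10-cycle admits a star 9-edge-coloring. -/
theorem starChromaticIndex_cycleSq_ten : starChromaticIndex (cycleSq 10) ≤ 9 := by
  exact Nat.sInf_le ⟨cycleSqTenColoring, isStarEdgeColoring_cycleSqTenColoring⟩
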